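/- arXiv:math-ph/0601057 — 3 statements merged into one kernel-verified Lean document; each statement's English description precedes it below -/
import Mathlib

section
/- For every γ ∈ ℝ, one has Θ(γ) < 1. -/
open MeasureTheory Set Filter

/-- An admissible function on the half-line `[0,∞)`: `u` is continuous on `[0,∞)`,
locally absolutely continuous with derivative `u'` (expressed by the integral
representation), and `u`, `u'`, `t·u(t)` all belong to `L²((0,∞))`. -/
structure AdmissibleHL (u u' : ℝ → ℂ) : Prop where
  cont : ContinuousOn u (Ici 0)
  locInt : ∀ t ∈ Ici (0:ℝ), IntervalIntegrable u' volume 0 t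
  ac : ∀ t ∈ Ici (0:ℝ), u t = u 0 + ∫ s in (0:ℝ)..t, u' s
  memL2 : IntegrableOn (fun t => ‖u t‖ ^ 2) (Ioi 0)
  memL2' : IntegrableOn (fun t => ‖u' t‖ ^ 2) (Ioi 0)
  memL2t : IntegrableOn (fun t => t ^ 2 * ‖u t‖ ^ 2) (Ioi 0)

/-- The quadratic form `q[γ,ξ](u) = ∫₀^∞ (|u'|² + (t-ξ)²|u|²) dt + γ|u(0)|²`. -/
noncomputable def qform (γ ξ : ℝ) (u u' : ℝ → ℂ) : ℝ :=
  (∫ t in Ioi (0:ℝ), (‖u' t‖ ^ 2 + (t - ξ) ^ 2 * ‖u t‖ ^ 2)) + γ * ‖u 0‖ ^ 2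

/-- The ground state energy `μ⁽¹⁾(γ,ξ)`: the infimum of the Rayleigh quotients of
the quadratic form `q[γ,ξ]` over admissible functions not identically zero. -/
noncomputable def mu1 (γ ξ : ℝ) : ℝ :=
  sInf { r : ℝ | ∃ u u' : ℝ → ℂ, AdmissibleHL u u' ∧ (∃ t ∈ Ici (0:ℝ), u t ≠ 0) ∧
    r = qform γ ξ u u' / ∫ t in Ioi (0:ℝ), ‖u t‖ ^ 2 }

/-- `Θ(γ) = inf_{ξ ∈ ℝ} μ⁽¹⁾(γ,ξ)`. -/
noncomputable def Theta (γ : ℝ) : ℝ := ⨅ ξ : ℝ, mu1 γ ξ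

/-- A ground state of `H[γ,ξ]` with eigenvalue `μ`: a twice continuously differentiable
positive function on `[0,∞)`, `L²`-normalized, with `φ, φ', t²·φ(t) ∈ L²((0,∞))`,
satisfying `-φ'' + (t-ξ)²φ = μ·φ` on `[0,∞)` and the boundary condition `φ'(0) = γ·φ(0)`. -/
structure IsGroundState (γ ξ μ : ℝ) (φ φ' φ'' : ℝ → ℝ) : Prop where
  deriv1 : ∀ t ∈ Ici (0:ℝ), HasDerivWithinAt φ (φ' t) (Ici 0) t
  deriv2 : ∀ t ∈ Ici (0:ℝ), HasDerivWithinAt φ' (φ'' t) (Ici 0) t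
  cont2 : ContinuousOn φ'' (Ici 0)
  pos : ∀ t ∈ Ici (0:ℝ), 0 < φ t
  normalized : (∫ t in Ioi (0:ℝ), (φ t) ^ 2) = 1
  memL2 : IntegrableOn (fun t => (φ t) ^ 2) (Ioi 0)
  memL2' : IntegrableOn (fun t => (φ' t) ^ 2) (Ioi 0)
  memL2t : IntegrableOn (fun t => (t ^ 2 * φ t) ^ 2) (Ioi 0)
  eqn : ∀ t ∈ Ici (0:ℝ), -φ'' t + (t - ξ) ^ 2 * φ t = μ * φ t
  bc : φ' 0 = γ * φ 0

theorem integrable_sub_pow_mul_exp_neg_sub_sq (ξ : ℝ) (n : ℕ) :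
    Integrable (fun t : ℝ => (t - ξ) ^ n * Real.exp (-(t - ξ) ^ 2)) := by
  have h := (integrable_rpow_mul_exp_neg_mul_sq one_pos
    (show (-1 : ℝ) < (n : ℝ) by linarith [n.cast_nonneg (α := ℝ)])).comp_sub_right ξ
  simpa using h

/-- The Gaussian centred at `ξ`, the trial function for the Rayleigh quotient. -/
noncomputable def gaussianTrial (ξ t : ℝ) : ℂ := (Real.exp (-(t - ξ) ^ 2 / 2) : ℝ)

/-- The derivative of the Gaussian centred at `ξ`. -/
noncomputable def gaussianTrialDeriv (ξ t : ℝ) : ℂ :=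
  (Real.exp (-(t - ξ) ^ 2 / 2) * -(t - ξ) : ℝ)

theorem norm_gaussianTrial_sq (ξ t : ℝ) :
    ‖gaussianTrial ξ t‖ ^ 2 = Real.exp (-(t - ξ) ^ 2) := by
  rw [gaussianTrial, Complex.norm_real, Real.norm_eq_abs, sq_abs, ← Real.exp_nat_mul]
  congr 1
  push_cast
  ring

theorem norm_gaussianTrialDeriv_sq (ξ t : ℝ) :
    ‖gaussianTrialDeriv ξ t‖ ^ 2 = (t - ξ) ^ 2 * Real.exp (-(t - ξ) ^ 2) := by
  rw [gaussianTrialDeriv, Complex.norm_real, Real.norm_eq_abs, sq_abs, mul_pow,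
    ← Real.exp_nat_mul, neg_sq, mul_comm]
  congr 2
  push_cast
  ring

theorem hasDerivAt_gaussianTrial (ξ t : ℝ) :
    HasDerivAt (gaussianTrial ξ) (gaussianTrialDeriv ξ t) t := by
  have h : HasDerivAt (fun t : ℝ => -(t - ξ) ^ 2 / 2) (-(t - ξ)) t := by
    refine (((hasDerivAt_id' t).sub_const ξ).pow 2).neg.div_const 2 |>.congr_deriv ?_
    push_cast
    ring
  exact h.exp.ofReal_comp

theorem continuous_gaussianTrialDeriv (ξ : ℝ) : Continuous (gaussianTrialDeriv ξ) := by
  unfold gaussianTrialDeriv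
  fun_prop

theorem admissibleHL_gaussianTrial (ξ : ℝ) :
    AdmissibleHL (gaussianTrial ξ) (gaussianTrialDeriv ξ) where
  cont t _ := (hasDerivAt_gaussianTrial ξ t).continuousAt.continuousWithinAt
  locInt t _ := (continuous_gaussianTrialDeriv ξ).intervalIntegrable 0 t
  ac t _ := by
    rw [intervalIntegral.integral_eq_sub_of_hasDerivAt
      (fun s _ => hasDerivAt_gaussianTrial ξ s)
      ((continuous_gaussianTrialDeriv ξ).intervalIntegrable 0 t)]
    ring
  memL2 := by
    simp_rw [norm_gaussianTrial_sq]
    simpa using (integrable_sub_pow_mul_exp_neg_sub_sq ξ 0).integrableOn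
  memL2' := by
    simp_rw [norm_gaussianTrialDeriv_sq]
    exact (integrable_sub_pow_mul_exp_neg_sub_sq ξ 2).integrableOn
  memL2t := by
    simp_rw [norm_gaussianTrial_sq]
    refine Integrable.integrableOn ?_
    refine ((integrable_sub_pow_mul_exp_neg_sub_sq ξ 2).add
      ((integrable_sub_pow_mul_exp_neg_sub_sq ξ 1).const_mul (2 * ξ))).add
      ((integrable_sub_pow_mul_exp_neg_sub_sq ξ 0).const_mul (ξ ^ 2)) |>.congr
      (ae_of_all _ fun t => ?_)
    simp only [Pi.add_apply]
    ring

theorem integral_Ioi_gaussian_energy (ξ : ℝ) :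
    ∫ t in Ioi (0 : ℝ), (2 * ((t - ξ) ^ 2 * Real.exp (-(t - ξ) ^ 2)) - Real.exp (-(t - ξ) ^ 2)) =
      -ξ * Real.exp (-ξ ^ 2) := by
  have hderiv (t : ℝ) : HasDerivAt (fun t : ℝ => -((t - ξ) * Real.exp (-(t - ξ) ^ 2)))
      (2 * ((t - ξ) ^ 2 * Real.exp (-(t - ξ) ^ 2)) - Real.exp (-(t - ξ) ^ 2)) t := by
    have h1 := (hasDerivAt_id' t).sub_const ξ
    refine (h1.mul (h1.pow 2).neg.exp).neg.congr_deriv ?_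
    simp only [Pi.neg_apply, Pi.pow_apply]
    push_cast
    ring
  have hint : IntegrableOn (fun t : ℝ =>
      2 * ((t - ξ) ^ 2 * Real.exp (-(t - ξ) ^ 2)) - Real.exp (-(t - ξ) ^ 2)) (Ioi 0) := by
    refine Integrable.integrableOn ?_
    simpa using ((integrable_sub_pow_mul_exp_neg_sub_sq ξ 2).const_mul 2).sub'
      (integrable_sub_pow_mul_exp_neg_sub_sq ξ 0)
  have hint0 : IntegrableOn (fun t : ℝ => -((t - ξ) * Real.exp (-(t - ξ) ^ 2))) (Ioi 0) := by
    simpa using (integrable_sub_pow_mul_exp_neg_sub_sq ξ 1).neg.integrableOn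
  have hlim := tendsto_zero_of_hasDerivAt_of_integrableOn_Ioi (fun t _ => hderiv t) hint hint0
  rw [integral_Ioi_of_hasDerivAt_of_tendsto' (fun t _ => hderiv t) hint hlim]
  simp

theorem qform_gaussianTrial (γ ξ : ℝ) :
    qform γ ξ (gaussianTrial ξ) (gaussianTrialDeriv ξ) =
      (∫ t in Ioi (0 : ℝ), ‖gaussianTrial ξ t‖ ^ 2) + (γ - ξ) * Real.exp (-ξ ^ 2) := by
  have h0 : IntegrableOn (fun t : ℝ => Real.exp (-(t - ξ) ^ 2)) (Ioi 0) := by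
    simpa using (integrable_sub_pow_mul_exp_neg_sub_sq ξ 0).integrableOn
  have h2 : IntegrableOn (fun t : ℝ => 2 * ((t - ξ) ^ 2 * Real.exp (-(t - ξ) ^ 2))) (Ioi 0) :=
    ((integrable_sub_pow_mul_exp_neg_sub_sq ξ 2).const_mul 2).integrableOn
  have h := integral_Ioi_gaussian_energy ξ
  rw [integral_sub h2 h0] at h
  simp_rw [qform, norm_gaussianTrial_sq, norm_gaussianTrialDeriv_sq, ← two_mul]
  rw [zero_sub, neg_sq]
  linarith

theorem integral_norm_gaussianTrial_sq_pos (ξ : ℝ) :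
    0 < ∫ t in Ioi (0 : ℝ), ‖gaussianTrial ξ t‖ ^ 2 := by
  have h0 := (admissibleHL_gaussianTrial ξ).memL2
  simp_rw [norm_gaussianTrial_sq] at h0 ⊢
  rw [setIntegral_pos_iff_support_of_nonneg_ae (ae_of_all _ fun t => (Real.exp_pos _).le) h0]
  have : Function.support (fun t : ℝ => Real.exp (-(t - ξ) ^ 2)) = univ := by
    ext t
    simp
  simp [this]

/-- An infimum of reals that is not bounded below is `0`, so no boundedness is needed here. -/
theorem Real.sInf_lt_one_of_mem {s : Set ℝ} {r : ℝ} (hr : r ∈ s) (h : r < 1) : sInf s < 1 := by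
  by_cases hs : BddBelow s
  · exact (csInf_le hs hr).trans_lt h
  · rw [Real.sInf_of_not_bddBelow hs]
    exact one_pos

theorem mu1_lt_one_of_lt {γ ξ : ℝ} (h : γ < ξ) : mu1 γ ξ < 1 := by
  refine Real.sInf_lt_one_of_mem ⟨gaussianTrial ξ, gaussianTrialDeriv ξ,
    admissibleHL_gaussianTrial ξ, ⟨0, self_mem_Ici, ?_⟩, rfl⟩ ?_
  · exact Complex.ofReal_ne_zero.mpr (Real.exp_ne_zero _)
  · rw [div_lt_one (integral_norm_gaussianTrial_sq_pos ξ), qform_gaussianTrial]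
    linarith [mul_neg_of_neg_of_pos (sub_neg.mpr h) (Real.exp_pos (-ξ ^ 2))]

/-- For every `γ ∈ ℝ`, one has `Θ(γ) < 1`. -/
theorem Theta_lt_one (γ : ℝ) : Theta γ < 1 :=
  Real.sInf_lt_one_of_mem (mem_range_self (γ + 1)) (mu1_lt_one_of_lt (lt_add_one γ))
end

section
/- Fix γ, ξ ∈ ℝ and let φ be a ground state of H[γ,ξ]. Then the function ξ' ↦ μ⁽¹⁾(γ,ξ') is differentiable at ξ' = ξ, with derivative equal to (ξ² − μ⁽¹⁾(γ,ξ) − γ²)·|φ(0)|² (the F-formula). -/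
open MeasureTheory Set Filter

open scoped Topology

/-- On `[0, R]` the function `f` is the indefinite integral of the integrable function `f'`. -/
structure IsPrimitiveOn (f f' : ℝ → ℝ) (R : ℝ) : Prop where
  integrable : IntervalIntegrable f' volume 0 R
  eq_integral : ∀ t ∈ Icc 0 R, f t = f 0 + ∫ s in (0:ℝ)..t, f' s

namespace IsPrimitiveOn

variable {f f' k k' : ℝ → ℝ} {R : ℝ}

lemma mono (hf : IsPrimitiveOn f f' R) {S : ℝ} (hS : S ∈ Icc 0 R) : IsPrimitiveOn f f' S where
  integrable := hf.integrable.mono_set (by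
    rw [uIcc_of_le hS.1, uIcc_of_le (hS.1.trans hS.2)]; exact Icc_subset_Icc_right hS.2)
  eq_integral := fun t ht => hf.eq_integral t ⟨ht.1, ht.2.trans hS.2⟩

lemma absolutelyContinuous (hf : IsPrimitiveOn f f' R) :
    AbsolutelyContinuousOnInterval (fun t => f 0 + ∫ s in (0:ℝ)..t, f' s) 0 R := by
  have h1 : AbsolutelyContinuousOnInterval (fun _ : ℝ => f 0) 0 R :=
    (LipschitzWith.const (f 0)).lipschitzOnWith.absolutelyContinuousOnInterval
  exact h1.fun_add
    (hf.integrable.absolutelyContinuousOnInterval_intervalIntegral (c := 0) (by simp))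

lemma continuousOn (hf : IsPrimitiveOn f f' R) (hR : 0 ≤ R) : ContinuousOn f (Icc 0 R) := by
  have := hf.absolutelyContinuous.continuousOn
  rw [uIcc_of_le hR] at this
  exact this.congr hf.eq_integral

lemma integral_mul_eq_sub (hf : IsPrimitiveOn f f' R) (hk : IsPrimitiveOn k k' R) (hR : 0 ≤ R) :
    ∫ t in (0:ℝ)..R, (f' t * k t + f t * k' t) = f R * k R - f 0 * k 0 := by
  have h1 := hf.absolutelyContinuous.integral_deriv_mul_eq_sub hk.absolutelyContinuous
  rw [← hf.eq_integral R ⟨hR, le_rfl⟩, ← hk.eq_integral R ⟨hR, le_rfl⟩] at h1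
  simp only [intervalIntegral.integral_same, add_zero] at h1
  rw [← h1]
  apply intervalIntegral.integral_congr_ae
  filter_upwards [hf.integrable.ae_hasDerivAt_integral, hk.integrable.ae_hasDerivAt_integral]
    with t h2 h3 ht
  have ht' : t ∈ uIcc 0 R := uIoc_subset_uIcc ht
  have hd1 := ((h2 ht' 0 (by simp)).const_add (f 0)).deriv
  have hd2 := ((h3 ht' 0 (by simp)).const_add (k 0)).deriv
  rw [hd1, hd2]
  rw [uIcc_of_le hR] at ht'
  rw [← hf.eq_integral t ht', ← hk.eq_integral t ht']

lemma mul (hf : IsPrimitiveOn f f' R) (hk : IsPrimitiveOn k k' R) (hR : 0 ≤ R) :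
    IsPrimitiveOn (fun t => f t * k t) (fun t => f' t * k t + f t * k' t) R where
  integrable := by
    have h1 := hf.continuousOn hR
    have h2 := hk.continuousOn hR
    rw [← uIcc_of_le hR] at h1 h2
    exact (hf.integrable.mul_continuousOn h2).add (hk.integrable.continuousOn_mul h1)
  eq_integral := fun t ht => by
    rw [(hf.mono ht).integral_mul_eq_sub (hk.mono ht) ht.1]; ring

lemma of_hasDerivWithinAt (hf : ∀ t ∈ Ici (0:ℝ), HasDerivWithinAt f (f' t) (Ici 0) t)
    (hf' : ContinuousOn f' (Ici 0)) (hR : 0 ≤ R) : IsPrimitiveOn f f' R := by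
  have hInt : ∀ t, 0 ≤ t → IntervalIntegrable f' volume 0 t := fun t ht =>
    ContinuousOn.intervalIntegrable (hf'.mono (by
      rw [uIcc_of_le ht]; exact Icc_subset_Ici_self))
  refine ⟨hInt R hR, fun t ht => ?_⟩
  rw [intervalIntegral.integral_eq_sub_of_hasDerivAt_of_le ht.1
    (fun s hs => ((hf s hs.1).continuousWithinAt).mono Icc_subset_Ici_self)
    (fun s hs => (hf s hs.1.le).hasDerivAt (Ici_mem_nhds hs.1)) (hInt t ht.1)]
  ring

/-- Completing the square in `∫ (f' - g f)² ≥ 0`. -/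
lemma sq_integral_ge {g g' : ℝ → ℝ} (hf : IsPrimitiveOn f f' R) (hg : IsPrimitiveOn g g' R)
    (hg' : ContinuousOn g' (Icc 0 R)) (hR : 0 ≤ R)
    (hf2 : IntervalIntegrable (fun t => f' t ^ 2) volume 0 R) :
    g R * f R ^ 2 - g 0 * f 0 ^ 2 ≤
      ∫ t in (0:ℝ)..R, (f' t ^ 2 + (g' t + g t ^ 2) * f t ^ 2) := by
  have hff := hf.mul hf hR
  have h1 := hg.integral_mul_eq_sub hff hR
  have hcf := hf.continuousOn hR
  have hcg := hg.continuousOn hR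
  calc _ = g R * (f R * f R) - g 0 * (f 0 * f 0) := by ring
    _ ≤ _ := by
      rw [← h1]
      refine intervalIntegral.integral_mono_on hR (hg.mul hff hR).integrable (hf2.add ?_) ?_
      · apply ContinuousOn.intervalIntegrable
        rw [uIcc_of_le hR]
        exact (hg'.add (hcg.pow 2)).mul (hcf.pow 2)
      · intro t _
        nlinarith [sq_nonneg (f' t - g t * f t)]

end IsPrimitiveOn

lemma not_integrableOn_Ioi_of_le {f : ℝ → ℝ} {a b c : ℝ} (hc : 0 < c)
    (hf : IntegrableOn f (Ioi a)) (hab : a ≤ b) (hle : ∀ t ∈ Ioi b, c ≤ f t) : False := by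
  have h1 : IntegrableOn (fun _ : ℝ => c) (Ioi b) := by
    refine Integrable.mono' (hf.mono_set (Ioi_subset_Ioi hab)) aestronglyMeasurable_const ?_
    filter_upwards [ae_restrict_mem measurableSet_Ioi] with t ht
    rw [Real.norm_of_nonneg hc.le]
    exact hle t ht
  rw [integrableOn_const_iff] at h1
  simp [hc.ne'] at h1

/-- A square integrable function with `p' ≥ K' p`, `K' ≥ 0`, cannot be positive. -/
lemma nonpos_of_deriv_ge {p p' K K' : ℝ → ℝ} {T : ℝ}
    (hp : ∀ t ∈ Ioi T, HasDerivAt p (p' t) t) (hK : ∀ t ∈ Ioi T, HasDerivAt K (K' t) t)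
    (hK0 : ∀ t ∈ Ioi T, 0 ≤ K' t) (hge : ∀ t ∈ Ioi T, K' t * p t ≤ p' t)
    (hInt : IntegrableOn (fun t => p t ^ 2) (Ioi T)) : ∀ t ∈ Ioi T, p t ≤ 0 := by
  intro a ha
  by_contra! hpa
  have hKm : MonotoneOn K (Ioi T) := by
    apply monotoneOn_of_deriv_nonneg (convex_Ioi T)
    · exact fun t ht => (hK t ht).continuousAt.continuousWithinAt
    · rw [interior_Ioi]; exact fun t ht => (hK t ht).differentiableAt.differentiableWithinAt
    · rw [interior_Ioi]; intro t ht; rw [(hK t ht).deriv]; exact hK0 t ht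
  have hd : ∀ t ∈ Ioi T, HasDerivAt (fun t => p t * Real.exp (-K t))
      (p' t * Real.exp (-K t) + p t * (Real.exp (-K t) * -K' t)) t :=
    fun t ht => (hp t ht).mul ((hK t ht).neg.exp)
  have hqm : MonotoneOn (fun t => p t * Real.exp (-K t)) (Ioi T) := by
    apply monotoneOn_of_deriv_nonneg (convex_Ioi T)
    · exact fun t ht => (hd t ht).continuousAt.continuousWithinAt
    · rw [interior_Ioi]; exact fun t ht => (hd t ht).differentiableAt.differentiableWithinAt
    · rw [interior_Ioi]
      intro t ht
      rw [(hd t ht).deriv]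
      have := mul_nonneg (sub_nonneg.2 (hge t ht)) (Real.exp_pos (-K t)).le
      linarith
  refine not_integrableOn_Ioi_of_le (pow_pos hpa 2) hInt (le_of_lt ha) fun t ht => ?_
  have htT : t ∈ Ioi T := lt_trans (mem_Ioi.1 ha) (mem_Ioi.1 ht)
  have h1 := hqm ha htT (le_of_lt ht)
  have h2 : Real.exp (-K t) ≤ Real.exp (-K a) :=
    Real.exp_le_exp.2 (neg_le_neg (hKm ha htT (le_of_lt ht)))
  have h3 : p a ≤ p t := by
    by_contra! hlt
    have := mul_lt_mul_of_pos_right hlt (Real.exp_pos (-K t))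
    have := mul_le_mul_of_nonneg_left h2 hpa.le
    simp only at h1
    linarith
  exact pow_le_pow_left₀ hpa.le h3 2

namespace AdmissibleHL

variable {u u' : ℝ → ℂ}

lemma isPrimitiveOn_comp (hu : AdmissibleHL u u') (L : ℂ →L[ℝ] ℝ) {R : ℝ} (hR : 0 ≤ R) :
    IsPrimitiveOn (fun t => L (u t)) (fun t => L (u' t)) R where
  integrable := by
    have h1 := hu.locInt R hR
    rw [intervalIntegrable_iff] at h1 ⊢
    exact L.integrable_comp h1
  eq_integral := fun t ht => by
    rw [L.intervalIntegral_comp_comm (hu.locInt t ht.1), hu.ac t ht.1, map_add]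

lemma intervalIntegrable_sq (hu : AdmissibleHL u u') {R : ℝ} (hR : 0 ≤ R) :
    IntervalIntegrable (fun t => ‖u' t‖ ^ 2) volume 0 R := by
  rw [intervalIntegrable_iff, uIoc_of_le hR]
  exact hu.memL2'.mono_set Ioc_subset_Ioi_self

lemma intervalIntegrable_sq_comp (hu : AdmissibleHL u u') {L : ℂ →L[ℝ] ℝ}
    (hL : ∀ z, |L z| ≤ ‖z‖) {R : ℝ} (hR : 0 ≤ R) :
    IntervalIntegrable (fun t => L (u' t) ^ 2) volume 0 R := by
  have h1 := hu.intervalIntegrable_sq hR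
  have h2 := (hu.isPrimitiveOn_comp L hR).integrable
  rw [intervalIntegrable_iff] at h1 h2 ⊢
  refine Integrable.mono' h1 (h2.aestronglyMeasurable.pow 2) ?_
  filter_upwards with t
  rw [Real.norm_of_nonneg (sq_nonneg _), ← sq_abs]
  exact pow_le_pow_left₀ (abs_nonneg _) (hL _) 2

lemma integrableOn_form (hu : AdmissibleHL u u') (ξ : ℝ) :
    IntegrableOn (fun t => ‖u' t‖ ^ 2 + (t - ξ) ^ 2 * ‖u t‖ ^ 2) (Ioi 0) := by
  have hm : AEStronglyMeasurable (fun t => (t - ξ) ^ 2 * ‖u t‖ ^ 2)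
      (volume.restrict (Ioi (0:ℝ))) := by
    refine ContinuousOn.aestronglyMeasurable ?_ measurableSet_Ioi
    have := hu.cont.mono Ioi_subset_Ici_self
    fun_prop
  refine hu.memL2'.add (Integrable.mono' ((hu.memL2t.const_mul 2).add
    (hu.memL2.const_mul (2 * ξ ^ 2))) hm ?_)
  filter_upwards with t
  rw [Real.norm_of_nonneg (by positivity)]
  simp only [Pi.add_apply]
  nlinarith [mul_nonneg (sq_nonneg (t + ξ)) (sq_nonneg ‖u t‖)]

lemma integrableOn_mul_sq (hu : AdmissibleHL u u') :
    IntegrableOn (fun t => t * ‖u t‖ ^ 2) (Ioi 0) := by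
  have hm : AEStronglyMeasurable (fun t => t * ‖u t‖ ^ 2)
      (volume.restrict (Ioi (0:ℝ))) := by
    refine ContinuousOn.aestronglyMeasurable ?_ measurableSet_Ioi
    have := hu.cont.mono Ioi_subset_Ici_self
    fun_prop
  refine Integrable.mono' (hu.memL2t.add hu.memL2) hm ?_
  filter_upwards [ae_restrict_mem measurableSet_Ioi] with t ht
  rw [Real.norm_of_nonneg (mul_nonneg (le_of_lt ht) (sq_nonneg _))]
  simp only [Pi.add_apply]
  nlinarith [mul_nonneg (sq_nonneg (t - 1)) (sq_nonneg ‖u t‖),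
    mul_nonneg (sq_nonneg t) (sq_nonneg ‖u t‖), sq_nonneg ‖u t‖]

lemma norm_sq_eq (z : ℂ) : ‖z‖ ^ 2 = z.re ^ 2 + z.im ^ 2 := by
  rw [← Complex.normSq_eq_norm_sq, Complex.normSq_apply]; ring

/-- The truncated lower bound for the kinetic energy coming from a Riccati function `g`. -/
lemma sq_integral_ge (hu : AdmissibleHL u u') {g g' : ℝ → ℝ}
    (hg : ∀ t ∈ Ici (0:ℝ), HasDerivWithinAt g (g' t) (Ici 0) t)
    (hg' : ContinuousOn g' (Ici 0)) {R : ℝ} (hR : 0 ≤ R) :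
    g R * ‖u R‖ ^ 2 - g 0 * ‖u 0‖ ^ 2 ≤
      ∫ t in (0:ℝ)..R, (‖u' t‖ ^ 2 + (g' t + g t ^ 2) * ‖u t‖ ^ 2) := by
  have hgp : IsPrimitiveOn g g' R := .of_hasDerivWithinAt hg hg' hR
  have hgc := hg'.mono (Icc_subset_Ici_self : Icc 0 R ⊆ Ici (0:ℝ))
  have hgc0 := hgp.continuousOn hR
  have key : ∀ L : ℂ →L[ℝ] ℝ, (∀ z, |L z| ≤ ‖z‖) →
      IntervalIntegrable (fun t => L (u' t) ^ 2 + (g' t + g t ^ 2) * L (u t) ^ 2) volume 0 R := by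
    intro L hL
    refine (hu.intervalIntegrable_sq_comp hL hR).add (ContinuousOn.intervalIntegrable ?_)
    rw [uIcc_of_le hR]
    exact (hgc.add (hgc0.pow 2)).mul (((hu.isPrimitiveOn_comp L hR).continuousOn hR).pow 2)
  have hre : ∀ z, |Complex.reCLM z| ≤ ‖z‖ := Complex.abs_re_le_norm
  have him : ∀ z, |Complex.imCLM z| ≤ ‖z‖ := Complex.abs_im_le_norm
  have h1 := (hu.isPrimitiveOn_comp Complex.reCLM hR).sq_integral_ge hgp hgc hR
    (hu.intervalIntegrable_sq_comp hre hR)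
  have h2 := (hu.isPrimitiveOn_comp Complex.imCLM hR).sq_integral_ge hgp hgc hR
    (hu.intervalIntegrable_sq_comp him hR)
  have h3 := intervalIntegral.integral_add (key _ hre) (key _ him)
  have h4 : (∫ t in (0:ℝ)..R, (‖u' t‖ ^ 2 + (g' t + g t ^ 2) * ‖u t‖ ^ 2)) =
      ∫ t in (0:ℝ)..R, ((Complex.reCLM (u' t) ^ 2 + (g' t + g t ^ 2) * Complex.reCLM (u t) ^ 2) +
        (Complex.imCLM (u' t) ^ 2 + (g' t + g t ^ 2) * Complex.imCLM (u t) ^ 2)) := by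
    congr 1
    ext t
    rw [norm_sq_eq, norm_sq_eq]
    simp only [Complex.reCLM_apply, Complex.imCLM_apply]
    ring
  rw [h4, h3, norm_sq_eq, norm_sq_eq]
  simp only [Complex.reCLM_apply, Complex.imCLM_apply] at h1 h2 ⊢
  linarith

/-- A lower bound for the quadratic form from a Riccati subsolution of at most linear decay. -/
lemma mul_le_qform (hu : AdmissibleHL u u') {g g' : ℝ → ℝ} {γ ξ m K T : ℝ}
    (hg : ∀ t ∈ Ici (0:ℝ), HasDerivWithinAt g (g' t) (Ici 0) t)
    (hg' : ContinuousOn g' (Ici 0)) (hg0 : g 0 = γ)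
    (hgK : ∀ t, T ≤ t → -(K * t) ≤ g t)
    (hm : ∀ t ∈ Ici (0:ℝ), m ≤ (t - ξ) ^ 2 - g' t - g t ^ 2) :
    m * (∫ t in Ioi (0:ℝ), ‖u t‖ ^ 2) ≤ qform γ ξ u u' := by
  by_contra! hlt
  have hI := (hu.integrableOn_form ξ).sub (hu.memL2.const_mul m)
  have hlim := intervalIntegral_tendsto_integral_Ioi 0 hI tendsto_id
  have hsub : ∫ t in Ioi (0:ℝ), ((fun t => ‖u' t‖ ^ 2 + (t - ξ) ^ 2 * ‖u t‖ ^ 2) -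
      fun t => m * ‖u t‖ ^ 2) t = qform γ ξ u u' - γ * ‖u 0‖ ^ 2 -
        m * (∫ t in Ioi (0:ℝ), ‖u t‖ ^ 2) := by
    simp only [Pi.sub_apply]
    rw [integral_sub (hu.integrableOn_form ξ) (hu.memL2.const_mul m), integral_const_mul, qform]
    ring
  rw [hsub] at hlim
  set ε := m * (∫ t in Ioi (0:ℝ), ‖u t‖ ^ 2) - qform γ ξ u u' with hε
  have hε0 : 0 < ε := sub_pos.2 hlt
  have hev := hlim.eventually_lt_const (u := -γ * ‖u 0‖ ^ 2 - ε / 2) (by linarith)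
  obtain ⟨S, hS⟩ := eventually_atTop.1 (hev.and ((eventually_ge_atTop T).and
    (eventually_ge_atTop 0)))
  refine not_integrableOn_Ioi_of_le (half_pos hε0) (hu.integrableOn_mul_sq.const_mul K)
    (le_max_left 0 S) fun R hR => ?_
  obtain ⟨h1, h2, h3⟩ := hS R (le_of_lt (lt_of_le_of_lt (le_max_right 0 S) hR))
  have hgp : IsPrimitiveOn g g' R := .of_hasDerivWithinAt hg hg' h3
  have hgc0 := hgp.continuousOn h3
  have hgc := hg'.mono (Icc_subset_Ici_self : Icc 0 R ⊆ Ici (0:ℝ))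
  have huc := hu.cont.mono (Icc_subset_Ici_self : Icc 0 R ⊆ Ici (0:ℝ))
  have hmono : ∫ t in (0:ℝ)..R, (‖u' t‖ ^ 2 + (g' t + g t ^ 2) * ‖u t‖ ^ 2) ≤
      ∫ t in (0:ℝ)..R, ((fun t => ‖u' t‖ ^ 2 + (t - ξ) ^ 2 * ‖u t‖ ^ 2) -
        fun t => m * ‖u t‖ ^ 2) t := by
    refine intervalIntegral.integral_mono_on h3 ?_ ?_ ?_
    · refine (hu.intervalIntegrable_sq h3).add (ContinuousOn.intervalIntegrable ?_)
      rw [uIcc_of_le h3]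
      fun_prop
    · rw [intervalIntegrable_iff, uIoc_of_le h3]
      exact hI.mono_set Ioc_subset_Ioi_self
    · intro t ht
      simp only [Pi.sub_apply]
      nlinarith [mul_le_mul_of_nonneg_right (hm t ht.1) (sq_nonneg ‖u t‖)]
  have h4 := hu.sq_integral_ge hg hg' h3
  have h5 := mul_le_mul_of_nonneg_right (hgK R h2) (sq_nonneg ‖u R‖)
  rw [hg0] at h4
  simp only [id] at h1
  linarith

lemma integral_sq_pos (hu : AdmissibleHL u u') (hne : ∃ t ∈ Ici (0:ℝ), u t ≠ 0) :
    0 < ∫ t in Ioi (0:ℝ), ‖u t‖ ^ 2 := by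
  refine lt_of_le_of_ne (integral_nonneg fun t => sq_nonneg _) fun h0 => ?_
  have h1 := (integral_eq_zero_iff_of_nonneg (fun t => sq_nonneg _) hu.memL2).1 h0.symm
  have h2 : EqOn (fun t => ‖u t‖ ^ 2) 0 (Ici 0) := by
    rw [restrict_Ioi_eq_restrict_Ici] at h1
    exact Measure.eqOn_of_ae_eq h1 (hu.cont.norm.pow 2) continuousOn_const
      (by rw [interior_Ici, closure_Ioi])
  obtain ⟨t, ht, hut⟩ := hne
  have := h2 ht
  simp at this
  exact hut this

end AdmissibleHL

lemma integrableOn_mul_of_sq {a b : ℝ → ℝ} (ha : ContinuousOn a (Ioi 0))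
    (hb : ContinuousOn b (Ioi 0)) (ha2 : IntegrableOn (fun t => a t ^ 2) (Ioi 0))
    (hb2 : IntegrableOn (fun t => b t ^ 2) (Ioi 0)) :
    IntegrableOn (fun t => a t * b t) (Ioi 0) := by
  refine Integrable.mono' (ha2.add hb2) ((ha.mul hb).aestronglyMeasurable measurableSet_Ioi) ?_
  filter_upwards with t
  rw [Real.norm_eq_abs, abs_le]
  simp only [Pi.add_apply]
  constructor <;> nlinarith [sq_nonneg (a t - b t), sq_nonneg (a t + b t), sq_nonneg (a t),
    sq_nonneg (b t)]

namespace IsGroundState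

variable {γ ξ μ : ℝ} {φ φ' φ'' : ℝ → ℝ}

lemma hasDerivAt (h : IsGroundState γ ξ μ φ φ' φ'') {t : ℝ} (ht : t ∈ Ioi (0:ℝ)) :
    HasDerivAt φ (φ' t) t :=
  (h.deriv1 t (Ioi_subset_Ici_self ht)).hasDerivAt (Ici_mem_nhds ht)

lemma hasDerivAt' (h : IsGroundState γ ξ μ φ φ' φ'') {t : ℝ} (ht : t ∈ Ioi (0:ℝ)) :
    HasDerivAt φ' (φ'' t) t :=
  (h.deriv2 t (Ioi_subset_Ici_self ht)).hasDerivAt (Ici_mem_nhds ht)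

lemma continuousOn (h : IsGroundState γ ξ μ φ φ' φ'') : ContinuousOn φ (Ici 0) :=
  fun t ht => (h.deriv1 t ht).continuousWithinAt

lemma continuousOn' (h : IsGroundState γ ξ μ φ φ' φ'') : ContinuousOn φ' (Ici 0) :=
  fun t ht => (h.deriv2 t ht).continuousWithinAt

lemma second_deriv_eq (h : IsGroundState γ ξ μ φ φ' φ'') {t : ℝ} (ht : t ∈ Ici (0:ℝ)) :
    φ'' t = ((t - ξ) ^ 2 - μ) * φ t := by
  linarith [h.eqn t ht]

lemma integrableOn_mul_sq (h : IsGroundState γ ξ μ φ φ' φ'') :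
    IntegrableOn (fun t => t * φ t ^ 2) (Ioi 0) ∧
      IntegrableOn (fun t => t ^ 2 * φ t ^ 2) (Ioi 0) := by
  have hc := h.continuousOn.mono Ioi_subset_Ici_self
  have h2 : IntegrableOn (fun t => t ^ 2 * φ t ^ 2) (Ioi 0) :=
    (integrableOn_mul_of_sq hc (by fun_prop) h.memL2 h.memL2t).congr_fun
      (fun t _ => by ring) measurableSet_Ioi
  refine ⟨?_, h2⟩
  have h3 : IntegrableOn (fun t => (t * φ t) ^ 2) (Ioi 0) :=
    h2.congr_fun (fun t _ => by ring) measurableSet_Ioi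
  exact (integrableOn_mul_of_sq hc (by fun_prop) h.memL2 h3).congr_fun
      (fun t _ => by ring) measurableSet_Ioi

lemma integrableOn_potential (h : IsGroundState γ ξ μ φ φ' φ'') (a : ℝ) :
    IntegrableOn (fun t => (t - a) ^ 2 * φ t ^ 2) (Ioi 0) :=
  ((h.integrableOn_mul_sq.2.sub (h.integrableOn_mul_sq.1.const_mul (2 * a))).add
    (h.memL2.const_mul (a ^ 2))).congr_fun
      (fun t _ => by simp only [Pi.add_apply, Pi.sub_apply]; ring) measurableSet_Ioi

lemma integrableOn_moment (h : IsGroundState γ ξ μ φ φ' φ'') :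
    IntegrableOn (fun t => -2 * (t - ξ) * φ t ^ 2) (Ioi 0) :=
  IntegrableOn.congr_fun ((h.integrableOn_mul_sq.1.const_mul (-2)).add (h.memL2.const_mul (2 * ξ)))
      (fun t _ => by simp only [Pi.add_apply]; ring) measurableSet_Ioi

lemma integrableOn_mul_deriv (h : IsGroundState γ ξ μ φ φ' φ'') :
    IntegrableOn (fun t => φ t * φ' t) (Ioi 0) :=
  integrableOn_mul_of_sq (h.continuousOn.mono Ioi_subset_Ici_self)
    (h.continuousOn'.mono Ioi_subset_Ici_self) h.memL2 h.memL2'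

lemma tendsto_sq (h : IsGroundState γ ξ μ φ φ' φ'') :
    Tendsto (fun t => φ t ^ 2) atTop (𝓝 0) := by
  refine tendsto_zero_of_hasDerivAt_of_integrableOn_Ioi (a := 0)
    (f' := fun t => 2 * (φ t * φ' t)) (fun t ht => ?_)
    (h.integrableOn_mul_deriv.const_mul 2) h.memL2
  refine ((h.hasDerivAt ht).pow 2).congr_deriv ?_
  simp; ring

/-- The energy identity `q[γ,ξ](φ) = μ`. -/
lemma integral_energy (h : IsGroundState γ ξ μ φ φ' φ'') :
    (∫ t in Ioi (0:ℝ), (φ' t ^ 2 + (t - ξ) ^ 2 * φ t ^ 2)) + γ * φ 0 ^ 2 = μ := by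
  have hF : IntegrableOn (fun t => φ' t ^ 2 + (t - ξ) ^ 2 * φ t ^ 2) (Ioi 0) :=
    h.memL2'.add (h.integrableOn_potential ξ)
  have hd : ∀ t ∈ Ioi (0:ℝ), HasDerivAt (fun t => φ t * φ' t)
      ((φ' t ^ 2 + (t - ξ) ^ 2 * φ t ^ 2) - μ * φ t ^ 2) t := by
    intro t ht
    refine ((h.hasDerivAt ht).mul (h.hasDerivAt' ht)).congr_deriv ?_
    rw [h.second_deriv_eq (Ioi_subset_Ici_self ht)]; ring
  have hi : IntegrableOn (fun t => (φ' t ^ 2 + (t - ξ) ^ 2 * φ t ^ 2) - μ * φ t ^ 2) (Ioi 0) :=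
    hF.sub (h.memL2.const_mul μ)
  have h1 := integral_Ioi_of_hasDerivAt_of_tendsto
    ((h.continuousOn.mul h.continuousOn') 0 self_mem_Ici) hd hi
    (tendsto_zero_of_hasDerivAt_of_integrableOn_Ioi hd hi h.integrableOn_mul_deriv)
  have h2 := integral_sub hF (h.memL2.const_mul μ)
  rw [integral_const_mul, h.normalized] at h2
  rw [h2, Pi.mul_apply, h.bc] at h1
  linarith

/-- The function whose derivative is the integrand of the first moment. -/
lemma hasDerivWithinAt_moment (h : IsGroundState γ ξ μ φ φ' φ'') {t : ℝ} (ht : t ∈ Ici (0:ℝ)) :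
    HasDerivWithinAt (fun t => φ' t ^ 2 + (μ - (t - ξ) ^ 2) * φ t ^ 2)
      (-2 * (t - ξ) * φ t ^ 2) (Ici 0) t := by
  have h1 := ((hasDerivWithinAt_id t (Ici (0:ℝ))).sub_const ξ).pow 2
  have h2 := ((h.deriv2 t ht).pow 2).add ((h1.const_sub μ).mul ((h.deriv1 t ht).pow 2))
  refine h2.congr_deriv ?_
  rw [h.second_deriv_eq ht]
  simp
  ring

lemma tendsto_moment (h : IsGroundState γ ξ μ φ φ' φ'') :
    Tendsto (fun t => φ' t ^ 2 + (μ - (t - ξ) ^ 2) * φ t ^ 2) atTop (𝓝 0) := by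
  refine tendsto_zero_of_hasDerivAt_of_integrableOn_Ioi (a := 0)
    (fun t ht => (h.hasDerivWithinAt_moment (Ioi_subset_Ici_self ht)).hasDerivAt (Ici_mem_nhds ht))
    h.integrableOn_moment ?_
  exact ((h.memL2'.add (h.memL2.const_mul μ)).sub (h.integrableOn_potential ξ)).congr_fun
    (fun t _ => by simp only [Pi.add_apply, Pi.sub_apply]; ring) measurableSet_Ioi

lemma integral_moment (h : IsGroundState γ ξ μ φ φ' φ'') :
    ∫ t in Ioi (0:ℝ), -2 * (t - ξ) * φ t ^ 2 = (ξ ^ 2 - μ - γ ^ 2) * φ 0 ^ 2 := by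
  rw [integral_Ioi_of_hasDerivAt_of_tendsto
    (h.hasDerivWithinAt_moment self_mem_Ici).continuousWithinAt
    (fun t ht => (h.hasDerivWithinAt_moment (Ioi_subset_Ici_self ht)).hasDerivAt (Ici_mem_nhds ht))
    h.integrableOn_moment h.tendsto_moment, h.bc]
  ring

/-- The ground state, viewed as a complex function, is admissible. -/
lemma admissible (h : IsGroundState γ ξ μ φ φ' φ'') :
    AdmissibleHL (fun t => (φ t : ℂ)) (fun t => (φ' t : ℂ)) where
  cont := Complex.continuous_ofReal.comp_continuousOn h.continuousOn
  locInt := fun t ht => by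
    refine ContinuousOn.intervalIntegrable ?_
    rw [uIcc_of_le ht]
    exact Complex.continuous_ofReal.comp_continuousOn (h.continuousOn'.mono Icc_subset_Ici_self)
  ac := fun t ht => by
    rw [intervalIntegral.integral_ofReal, ← Complex.ofReal_add]
    exact congrArg _ ((IsPrimitiveOn.of_hasDerivWithinAt h.deriv1 h.continuousOn' ht).eq_integral t
      ⟨ht, le_rfl⟩)
  memL2 := by simpa using h.memL2
  memL2' := by simpa using h.memL2'
  memL2t := by simpa using h.integrableOn_mul_sq.2

lemma qform_eq (h : IsGroundState γ ξ μ φ φ' φ'') (δ : ℝ) :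
    qform γ (ξ + δ) (fun t => (φ t : ℂ)) (fun t => (φ' t : ℂ)) =
      μ + (ξ ^ 2 - μ - γ ^ 2) * φ 0 ^ 2 * δ + δ ^ 2 := by
  have hF : IntegrableOn (fun t => φ' t ^ 2 + (t - ξ) ^ 2 * φ t ^ 2) (Ioi 0) :=
    h.memL2'.add (h.integrableOn_potential ξ)
  have hG : IntegrableOn (fun t => φ' t ^ 2 + (t - ξ) ^ 2 * φ t ^ 2 +
      δ * (-2 * (t - ξ) * φ t ^ 2)) (Ioi 0) := hF.add (h.integrableOn_moment.const_mul δ)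
  have h1 := integral_add hG (h.memL2.const_mul (δ ^ 2))
  rw [integral_add hF (h.integrableOn_moment.const_mul δ), integral_const_mul, integral_const_mul,
    h.normalized, h.integral_moment] at h1
  have h2 := h.integral_energy
  simp only [qform, Complex.norm_real, Real.norm_eq_abs, sq_abs]
  have h3 : ∀ t, φ' t ^ 2 + (t - (ξ + δ)) ^ 2 * φ t ^ 2 = φ' t ^ 2 + (t - ξ) ^ 2 * φ t ^ 2 +
      δ * (-2 * (t - ξ) * φ t ^ 2) + δ ^ 2 * φ t ^ 2 := fun t => by ring
  simp only [h3]
  rw [h1]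
  linarith

/-- Eventual Gaussian type bounds on the logarithmic derivative. -/
lemma exists_log_deriv_bounds (h : IsGroundState γ ξ μ φ φ' φ'') :
    ∃ T, 0 ≤ T ∧ ∀ t ∈ Ioi T, -(2 * (t - ξ)) * φ t ≤ φ' t ∧ φ' t ≤ -((t - ξ) / 2) * φ t := by
  have hInt : ∀ c : ℝ, IntegrableOn (fun t => (φ' t + c * (t - ξ) * φ t) ^ 2) (Ioi 0) := by
    intro c
    have hc := h.continuousOn.mono Ioi_subset_Ici_self
    have hc' := h.continuousOn'.mono Ioi_subset_Ici_self
    refine Integrable.mono' ((h.memL2'.const_mul 2).add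
      ((h.integrableOn_potential ξ).const_mul (2 * c ^ 2)))
      (ContinuousOn.aestronglyMeasurable (by fun_prop) measurableSet_Ioi) ?_
    filter_upwards with t
    rw [Real.norm_of_nonneg (sq_nonneg _)]
    simp only [Pi.add_apply]
    nlinarith [sq_nonneg (φ' t - c * (t - ξ) * φ t)]
  have hd : ∀ c : ℝ, ∀ t ∈ Ioi (0:ℝ), HasDerivAt (fun t => φ' t + c * (t - ξ) * φ t)
      (((t - ξ) ^ 2 - μ) * φ t + (c * φ t + c * (t - ξ) * φ' t)) t := by
    intro c t ht
    have h1 := (((hasDerivAt_id t).sub_const ξ).const_mul c).mul (h.hasDerivAt ht)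
    refine ((h.hasDerivAt' ht).add h1).congr_deriv ?_
    rw [h.second_deriv_eq (Ioi_subset_Ici_self ht)]
    simp
  have hK : ∀ c t : ℝ, HasDerivAt (fun t => c / 2 * (t - ξ) ^ 2) (c * (t - ξ)) t := by
    intro c t
    refine ((((hasDerivAt_id t).sub_const ξ).pow 2).const_mul (c / 2)).congr_deriv ?_
    simp; ring
  have hT : ∀ t ∈ Ioi (|ξ| + |μ| + 2), 0 < t ∧ |μ| + 2 ≤ t - ξ := by
    intro t ht
    have := abs_nonneg ξ
    have := abs_nonneg μ
    have := le_abs_self ξ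
    have := mem_Ioi.1 ht
    constructor <;> linarith
  have hsub : Ioi (|ξ| + |μ| + 2) ⊆ Ioi (0:ℝ) := fun t ht => (hT t ht).1
  refine ⟨|ξ| + |μ| + 2, by positivity, fun t ht => ⟨?_, ?_⟩⟩
  · have := nonpos_of_deriv_ge (p := fun t => -(φ' t + 2 * (t - ξ) * φ t))
      (fun t ht => (hd 2 t (hT t ht).1).neg) (fun t _ => hK 2 t)
      (fun t ht => by have := (hT t ht).2; have := abs_nonneg μ; linarith)
      (fun t ht => by
        have h1 := (hT t ht).2
        have h2 := abs_nonneg μ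
        have h3 := neg_abs_le μ
        have h4 : 0 ≤ 3 * (t - ξ) ^ 2 + μ - 2 := by nlinarith
        nlinarith [mul_nonneg h4 (h.pos t (hT t ht).1.le).le])
      ((hInt 2).mono_set hsub |>.congr_fun (fun t _ => by ring) measurableSet_Ioi) t ht
    linarith
  · have := nonpos_of_deriv_ge (p := fun t => φ' t + 1 / 2 * (t - ξ) * φ t)
      (fun t ht => hd (1 / 2) t (hT t ht).1) (fun t _ => hK (1 / 2) t)
      (fun t ht => by have := (hT t ht).2; have := abs_nonneg μ; linarith)
      (fun t ht => by
        have h1 := (hT t ht).2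
        have h2 := abs_nonneg μ
        have h3 := le_abs_self μ
        have h4 : 0 ≤ 3 / 4 * (t - ξ) ^ 2 - μ + 1 / 2 := by nlinarith
        nlinarith [mul_nonneg h4 (h.pos t (hT t ht).1.le).le])
      ((hInt (1 / 2)).mono_set hsub) t ht
    linarith

/-- The numerator of the first order corrector: it vanishes at `0` and at infinity. -/
lemma exists_corrector_numerator (h : IsGroundState γ ξ μ φ φ' φ'') :
    ∃ w : ℝ → ℝ, w 0 = 0 ∧ Tendsto w atTop (𝓝 0) ∧ ∀ t ∈ Ici (0:ℝ), HasDerivWithinAt w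
      ((-2 * (t - ξ) - (ξ ^ 2 - μ - γ ^ 2) * φ 0 ^ 2) * φ t ^ 2) (Ici 0) t := by
  set D := (ξ ^ 2 - μ - γ ^ 2) * φ 0 ^ 2 with hD
  have hψ : Continuous fun t => φ (max t 0) ^ 2 := by
    have : Continuous fun t : ℝ => φ (max t 0) :=
      h.continuousOn.comp_continuous (by fun_prop) fun t => le_max_right t 0
    exact this.pow 2
  have hψe : EqOn (fun t => φ t ^ 2) (fun t => φ (max t 0) ^ 2) (Ioi 0) := fun t ht => by
    simp only [max_eq_left (le_of_lt (mem_Ioi.1 ht))]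
  have hψi := h.memL2.congr_fun hψe measurableSet_Ioi
  have hψ1 : ∫ t in Ioi (0:ℝ), φ (max t 0) ^ 2 = 1 := by
    rw [← setIntegral_congr_fun measurableSet_Ioi hψe, h.normalized]
  refine ⟨fun t => φ' t ^ 2 + (μ - (t - ξ) ^ 2) * φ t ^ 2 +
    (D - D * ∫ s in (0:ℝ)..t, φ (max s 0) ^ 2), ?_, ?_, fun t ht => ?_⟩
  · simp only [intervalIntegral.integral_same, h.bc, hD]
    ring
  · have h1 := intervalIntegral_tendsto_integral_Ioi 0 hψi tendsto_id
    rw [hψ1] at h1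
    have h2 := h.tendsto_moment.add ((h1.const_mul D).const_sub D)
    simpa using h2
  · have h1 := (hψ.integral_hasStrictDerivAt 0 t).hasDerivAt.hasDerivWithinAt (s := Ici 0)
    refine ((h.hasDerivWithinAt_moment ht).add ((h1.const_mul D).const_sub D)).congr_deriv ?_
    rw [max_eq_left ht]
    ring

/-- The bounded solution of the linearised Riccati equation. -/
lemma exists_corrector (h : IsGroundState γ ξ μ φ φ' φ'') :
    ∃ (k k' : ℝ → ℝ) (C : ℝ), k 0 = 0 ∧
      (∀ t ∈ Ici (0:ℝ), HasDerivWithinAt k (k' t) (Ici 0) t) ∧ ContinuousOn k' (Ici 0) ∧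
      (∀ t ∈ Ici (0:ℝ), |k t| ≤ C) ∧ ∀ t ∈ Ici (0:ℝ),
        k' t + 2 * (φ' t / φ t) * k t = -2 * (t - ξ) - (ξ ^ 2 - μ - γ ^ 2) * φ 0 ^ 2 := by
  obtain ⟨w, hw0, hwlim, hwd⟩ := h.exists_corrector_numerator
  set D := (ξ ^ 2 - μ - γ ^ 2) * φ 0 ^ 2
  obtain ⟨T, hT0, hT⟩ := h.exists_log_deriv_bounds
  have hne : ∀ t ∈ Ici (0:ℝ), φ t ≠ 0 := fun t ht => (h.pos t ht).ne'
  have hkc : ContinuousOn (fun t => w t / φ t ^ 2) (Ici 0) :=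
    ContinuousOn.div (fun t ht => (hwd t ht).continuousWithinAt) (h.continuousOn.pow 2)
      fun t ht => pow_ne_zero 2 (hne t ht)
  have hwAt : ∀ t, 0 < t → HasDerivAt w ((-2 * (t - ξ) - D) * φ t ^ 2) t := fun t ht =>
    (hwd t (mem_Ici.2 ht.le)).hasDerivAt (Ici_mem_nhds ht)
  set S := max T (|ξ| + |D|) + 1 with hS
  have hST : T < S := by have := le_max_left T (|ξ| + |D|); linarith
  have hS0 : 0 < S := by linarith
  have hSD : ∀ t ∈ Ici S, 0 < t ∧ T < t ∧ |D| ≤ t - ξ := by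
    intro t ht
    have h1 := mem_Ici.1 ht
    have := le_max_right T (|ξ| + |D|)
    have := le_abs_self ξ
    refine ⟨?_, ?_, ?_⟩ <;> linarith
  have hanti : AntitoneOn w (Ici S) := by
    apply antitoneOn_of_deriv_nonpos (convex_Ici S)
    · exact fun t ht => (hwAt t (hSD t ht).1).continuousAt.continuousWithinAt
    · rw [interior_Ici]
      exact fun t ht => (hwAt t (hSD t (Ioi_subset_Ici_self ht)).1).differentiableAt
        |>.differentiableWithinAt
    · rw [interior_Ici]
      intro t ht
      obtain ⟨h1, h2, h3⟩ := hSD t (Ioi_subset_Ici_self ht)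
      rw [(hwAt t h1).deriv]
      have h4 := neg_abs_le D
      have h5 := abs_nonneg D
      exact mul_nonpos_of_nonpos_of_nonneg (by linarith) (sq_nonneg _)
  have hd3 : ∀ t ∈ Ici S, HasDerivAt (fun t => w t - 3 * φ t ^ 2)
      ((-2 * (t - ξ) - D) * φ t ^ 2 - 3 * (2 * φ t * φ' t)) t := by
    intro t ht
    refine ((hwAt t (hSD t ht).1).sub
      (((h.hasDerivAt (hSD t ht).1).pow 2).const_mul 3)).congr_deriv ?_
    simp
  have hmono : MonotoneOn (fun t => w t - 3 * φ t ^ 2) (Ici S) := by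
    apply monotoneOn_of_deriv_nonneg (convex_Ici S)
    · exact fun t ht => (hd3 t ht).continuousAt.continuousWithinAt
    · rw [interior_Ici]
      exact fun t ht => (hd3 t (Ioi_subset_Ici_self ht)).differentiableAt.differentiableWithinAt
    · rw [interior_Ici]
      intro t ht
      obtain ⟨h1, h2, h3⟩ := hSD t (Ioi_subset_Ici_self ht)
      rw [(hd3 t (Ioi_subset_Ici_self ht)).deriv]
      have h4 := le_abs_self D
      have h5 := (h.pos t h1.le).le
      have h6 := mul_le_mul_of_nonneg_left (hT t h2).2 h5
      have h7 : 0 ≤ (t - ξ - D) * φ t ^ 2 := mul_nonneg (by linarith) (sq_nonneg _)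
      nlinarith
  have hlarge : ∀ t ∈ Ici S, |w t / φ t ^ 2| ≤ 3 := by
    intro t ht
    have hp := pow_pos (h.pos t (hSD t ht).1.le) 2
    have h1 : 0 ≤ w t := by
      refine le_of_tendsto hwlim ?_
      filter_upwards [eventually_ge_atTop t] with s hs
      exact hanti ht (le_trans (mem_Ici.1 ht) hs) hs
    have h2 : w t - 3 * φ t ^ 2 ≤ 0 := by
      have hl := hwlim.sub (h.tendsto_sq.const_mul 3)
      rw [mul_zero, sub_zero] at hl
      refine ge_of_tendsto hl ?_
      filter_upwards [eventually_ge_atTop t] with s hs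
      exact hmono ht (le_trans (mem_Ici.1 ht) hs) hs
    rw [abs_of_nonneg (div_nonneg h1 hp.le), div_le_iff₀ hp]
    linarith
  obtain ⟨M, hM⟩ := isCompact_Icc.exists_bound_of_continuousOn
    (hkc.mono (Icc_subset_Ici_self : Icc 0 S ⊆ Ici (0:ℝ)))
  refine ⟨fun t => w t / φ t ^ 2,
    fun t => -2 * (t - ξ) - D - 2 * (φ' t / φ t) * (w t / φ t ^ 2), max M 3,
    by simp [hw0], fun t ht => ?_, ?_, fun t ht => ?_, fun t _ => by ring⟩
  · refine ((hwd t ht).div ((h.deriv1 t ht).pow 2) (pow_ne_zero 2 (hne t ht))).congr_deriv ?_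
    have := hne t ht
    simp only [Pi.pow_apply]
    field_simp
    simp
    ring
  · have h1 : ContinuousOn (fun t => φ' t / φ t) (Ici 0) := h.continuousOn'.div h.continuousOn hne
    fun_prop
  · rcases le_total t S with hts | hts
    · exact (hM t ⟨ht, hts⟩).trans (le_max_left _ _)
    · exact (hlarge t hts).trans (le_max_right _ _)

/-- Quadratic lower bound for the form at shifted parameters. -/
lemma exists_qform_lower_bound (h : IsGroundState γ ξ μ φ φ' φ'') :
    ∃ C : ℝ, ∀ δ : ℝ, ∀ u u' : ℝ → ℂ, AdmissibleHL u u' →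
      (μ + (ξ ^ 2 - μ - γ ^ 2) * φ 0 ^ 2 * δ - C * δ ^ 2) * (∫ t in Ioi (0:ℝ), ‖u t‖ ^ 2) ≤
        qform γ (ξ + δ) u u' := by
  obtain ⟨k, k', C, hk0, hkd, hkc', hkC, hkeq⟩ := h.exists_corrector
  obtain ⟨T, hT0, hT⟩ := h.exists_log_deriv_bounds
  have hne : ∀ t ∈ Ici (0:ℝ), φ t ≠ 0 := fun t ht => (h.pos t ht).ne'
  have hgc : ContinuousOn (fun t => φ' t / φ t) (Ici 0) := h.continuousOn'.div h.continuousOn hne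
  refine ⟨C ^ 2, fun δ u u' hu => ?_⟩
  refine hu.mul_le_qform (g := fun t => φ' t / φ t + δ * k t)
    (g' := fun t => ((t - ξ) ^ 2 - μ - (φ' t / φ t) ^ 2) + δ * k' t) (K := 3)
    (T := max T (2 * |ξ| + |δ| * C) + 1) (fun t ht => ?_) ?_ ?_ (fun t ht => ?_) (fun t ht => ?_)
  · have h1 := (h.deriv2 t ht).div (h.deriv1 t ht) (hne t ht)
    refine (h1.add ((hkd t ht).const_mul δ)).congr_deriv ?_
    rw [h.second_deriv_eq ht]
    have := hne t ht
    field_simp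
  · fun_prop
  · simp only [hk0, h.bc, mul_zero, add_zero]
    exact mul_div_cancel_right₀ γ (hne 0 self_mem_Ici)
  · have h1 := le_max_left T (2 * |ξ| + |δ| * C)
    have h2 := le_max_right T (2 * |ξ| + |δ| * C)
    have ht0 : 0 ≤ t := by linarith
    have h3 := (le_div_iff₀ (h.pos t ht0)).2 (hT t (mem_Ioi.2 (by linarith))).1
    have h4 : |δ * k t| ≤ |δ| * C := by
      rw [abs_mul]; exact mul_le_mul_of_nonneg_left (hkC t ht0) (abs_nonneg δ)
    have h5 := neg_abs_le (δ * k t)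
    have h6 := neg_abs_le ξ
    linarith
  · have h1 := hkeq t ht
    have h2 : k t ^ 2 ≤ C ^ 2 := by
      rw [← sq_abs]; exact pow_le_pow_left₀ (abs_nonneg _) (hkC t ht) 2
    have h3 := mul_le_mul_of_nonneg_left h2 (sq_nonneg δ)
    have h4 := sq_nonneg δ
    have h5 : k' t = -2 * (t - ξ) - (ξ ^ 2 - μ - γ ^ 2) * φ 0 ^ 2 - 2 * (φ' t / φ t) * k t := by
      linarith
    simp only [h5]
    linarith

end IsGroundState

lemma hasDerivAt_of_quadratic_bounds {f : ℝ → ℝ} {x D A B : ℝ}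
    (hl : ∀ δ, f x + D * δ - A * δ ^ 2 ≤ f (x + δ))
    (hu : ∀ δ, f (x + δ) ≤ f x + D * δ + B * δ ^ 2) : HasDerivAt f D x := by
  rw [hasDerivAt_iff_isLittleO_nhds_zero]
  refine Asymptotics.IsBigO.trans_isLittleO (g := fun δ : ℝ => δ ^ 2) ?_ ?_
  · refine Asymptotics.IsBigO.of_bound (|A| + |B|) (Eventually.of_forall fun δ => ?_)
    rw [Real.norm_eq_abs, Real.norm_of_nonneg (sq_nonneg δ), abs_le, smul_eq_mul]
    have h1 := mul_le_mul_of_nonneg_right (le_abs_self A) (sq_nonneg δ)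
    have h2 := mul_le_mul_of_nonneg_right (le_abs_self B) (sq_nonneg δ)
    have h3 := mul_nonneg (abs_nonneg A) (sq_nonneg δ)
    have h4 := mul_nonneg (abs_nonneg B) (sq_nonneg δ)
    constructor <;> linarith [hl δ, hu δ]
  · exact Asymptotics.isLittleO_pow_id one_lt_two

/-- The F-formula: for a ground state `φ` of `H[γ,ξ]`, the function `ξ' ↦ μ⁽¹⁾(γ,ξ')`
is differentiable at `ξ` with derivative `(ξ² − μ⁽¹⁾(γ,ξ) − γ²)·|φ(0)|²`. -/
theorem F_formula (γ ξ : ℝ) (φ φ' φ'' : ℝ → ℝ)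
    (h : IsGroundState γ ξ (mu1 γ ξ) φ φ' φ'') :
    HasDerivAt (fun ξ' : ℝ => mu1 γ ξ')
      ((ξ ^ 2 - mu1 γ ξ - γ ^ 2) * (φ 0) ^ 2) ξ := by
  obtain ⟨C, hC⟩ := h.exists_qform_lower_bound
  have hle : ∀ δ, ∀ r ∈ { r : ℝ | ∃ u u' : ℝ → ℂ, AdmissibleHL u u' ∧
      (∃ t ∈ Ici (0:ℝ), u t ≠ 0) ∧
      r = qform γ (ξ + δ) u u' / ∫ t in Ioi (0:ℝ), ‖u t‖ ^ 2 },
      mu1 γ ξ + (ξ ^ 2 - mu1 γ ξ - γ ^ 2) * φ 0 ^ 2 * δ - C * δ ^ 2 ≤ r := by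
    rintro δ r ⟨u, u', hu, hne, rfl⟩
    rw [le_div_iff₀ (hu.integral_sq_pos hne)]
    exact hC δ u u' hu
  have hmem : ∀ δ, mu1 γ ξ + (ξ ^ 2 - mu1 γ ξ - γ ^ 2) * φ 0 ^ 2 * δ + 1 * δ ^ 2 ∈
      { r : ℝ | ∃ u u' : ℝ → ℂ, AdmissibleHL u u' ∧ (∃ t ∈ Ici (0:ℝ), u t ≠ 0) ∧
        r = qform γ (ξ + δ) u u' / ∫ t in Ioi (0:ℝ), ‖u t‖ ^ 2 } := by
    refine fun δ => ⟨_, _, h.admissible, ⟨0, self_mem_Ici, ?_⟩, ?_⟩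
    · exact Complex.ofReal_ne_zero.2 (h.pos 0 self_mem_Ici).ne'
    · rw [h.qform_eq]
      simp only [Complex.norm_real, Real.norm_eq_abs, sq_abs, h.normalized]
      ring
  exact hasDerivAt_of_quadratic_bounds (fun δ => le_csInf ⟨_, hmem δ⟩ (hle δ))
    fun δ => csInf_le ⟨_, hle δ⟩ (hmem δ)
end

section
/- For every γ ∈ ℝ there exists a constant C > 0 such that |Θ(γ+τ) − Θ(γ)| ≤ C·|τ| for all τ ∈ [−1,1]; that is, the function γ ↦ Θ(γ) is locally Lipschitz on ℝ. -/
open MeasureTheory Set Filter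

namespace AdmissibleHL

/-- The energy of an admissible function is integrable on the half-line. -/
lemma integrableOn_energy {u u' : ℝ → ℂ} (h : AdmissibleHL u u') (ξ : ℝ) :
    IntegrableOn (fun t => ‖u' t‖ ^ 2 + (t - ξ) ^ 2 * ‖u t‖ ^ 2) (Ioi 0) := by
  refine h.memL2'.add ?_
  have hmaj : IntegrableOn (fun t => 2 * (t ^ 2 * ‖u t‖ ^ 2) + 2 * ξ ^ 2 * ‖u t‖ ^ 2) (Ioi 0) :=
    (h.memL2t.const_mul 2).add (h.memL2.const_mul (2 * ξ ^ 2))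
  refine hmaj.mono' ?_ (ae_of_all _ fun t => ?_)
  · exact (by fun_prop : Measurable fun t : ℝ => (t - ξ) ^ 2).aestronglyMeasurable.mul
      h.memL2.aestronglyMeasurable
  · rw [Real.norm_of_nonneg (by positivity)]
    nlinarith [mul_nonneg (sq_nonneg (t + ξ)) (sq_nonneg ‖u t‖)]

/-- The Cauchy–Schwarz bound for the derivative on a bounded interval. -/
lemma sq_integral_norm_le {u u' : ℝ → ℂ} (h : AdmissibleHL u u') {δ : ℝ} (hδ : 0 < δ) :
    (∫ s in (0 : ℝ)..δ, ‖u' s‖) ^ 2 ≤ δ * ∫ t in Ioi (0 : ℝ), ‖u' t‖ ^ 2 := by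
  have hnorm : IntervalIntegrable (fun s => ‖u' s‖) volume 0 δ := (h.locInt δ hδ.le).norm
  have hsq : IntervalIntegrable (fun s => ‖u' s‖ ^ 2) volume 0 δ :=
    (intervalIntegrable_iff_integrableOn_Ioc_of_le hδ.le).2
      (h.memL2'.mono_set Ioc_subset_Ioi_self)
  have hle : ∫ s in (0 : ℝ)..δ, ‖u' s‖ ^ 2 ≤ ∫ t in Ioi (0 : ℝ), ‖u' t‖ ^ 2 := by
    rw [intervalIntegral.integral_of_le hδ.le]
    exact setIntegral_mono_set h.memL2' (ae_of_all _ fun t => sq_nonneg _)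
      Ioc_subset_Ioi_self.eventuallyLE
  set B := ∫ s in (0 : ℝ)..δ, ‖u' s‖ with hB
  have hlin : ∫ s in (0 : ℝ)..δ, (2 * B / δ * ‖u' s‖ - (B / δ) ^ 2) = B ^ 2 / δ := by
    rw [intervalIntegral.integral_sub (hnorm.const_mul _) intervalIntegrable_const,
      intervalIntegral.integral_const_mul, intervalIntegral.integral_const, ← hB, smul_eq_mul]
    field_simp
    ring
  have hmono : ∫ s in (0 : ℝ)..δ, (2 * B / δ * ‖u' s‖ - (B / δ) ^ 2) ≤
      ∫ s in (0 : ℝ)..δ, ‖u' s‖ ^ 2 := by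
    refine intervalIntegral.integral_mono_on hδ.le
      ((hnorm.const_mul _).sub intervalIntegrable_const) hsq fun s _ => ?_
    have := sq_nonneg (‖u' s‖ - B / δ)
    rw [mul_div_assoc]
    linarith
  rw [hlin] at hmono
  have := (div_le_iff₀ hδ).1 (hmono.trans hle)
  linarith

/-- Trace inequality: the boundary value is controlled by the `L²` norms of `u` and `u'`. -/
lemma trace_le {u u' : ℝ → ℂ} (h : AdmissibleHL u u') {δ : ℝ} (hδ : 0 < δ) :
    ‖u 0‖ ^ 2 ≤ 2 / δ * (∫ t in Ioi (0 : ℝ), ‖u t‖ ^ 2) +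
      2 * δ * ∫ t in Ioi (0 : ℝ), ‖u' t‖ ^ 2 := by
  set A := ∫ t in Ioi (0 : ℝ), ‖u' t‖ ^ 2
  have hpt : ∀ t ∈ Icc (0 : ℝ) δ, ‖u 0‖ ^ 2 - 2 * δ * A ≤ 2 * ‖u t‖ ^ 2 := by
    intro t ht
    have hint : ‖∫ s in (0 : ℝ)..t, u' s‖ ≤ ∫ s in (0 : ℝ)..δ, ‖u' s‖ := by
      refine (intervalIntegral.norm_integral_le_integral_norm ht.1).trans ?_
      exact intervalIntegral.integral_mono_interval le_rfl ht.1 ht.2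
        (ae_of_all _ fun s => norm_nonneg _) (h.locInt δ hδ.le).norm
    have htri : ‖u 0‖ ≤ ‖u t‖ + ∫ s in (0 : ℝ)..δ, ‖u' s‖ := by
      have h0 : u 0 = u t - ∫ s in (0 : ℝ)..t, u' s := by rw [h.ac t ht.1]; ring
      calc ‖u 0‖ = ‖u t - ∫ s in (0 : ℝ)..t, u' s‖ := by rw [← h0]
        _ ≤ ‖u t‖ + ‖∫ s in (0 : ℝ)..t, u' s‖ := norm_sub_le _ _
        _ ≤ _ := by gcongr
    have hsq := pow_le_pow_left₀ (norm_nonneg _) htri 2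
    nlinarith [sq_integral_norm_le h hδ, sq_nonneg (‖u t‖ - ∫ s in (0 : ℝ)..δ, ‖u' s‖)]
  have hsq : IntervalIntegrable (fun t => ‖u t‖ ^ 2) volume 0 δ :=
    (intervalIntegrable_iff_integrableOn_Ioc_of_le hδ.le).2
      (h.memL2.mono_set Ioc_subset_Ioi_self)
  have hle : ∫ t in (0 : ℝ)..δ, ‖u t‖ ^ 2 ≤ ∫ t in Ioi (0 : ℝ), ‖u t‖ ^ 2 := by
    rw [intervalIntegral.integral_of_le hδ.le]
    exact setIntegral_mono_set h.memL2 (ae_of_all _ fun t => sq_nonneg _)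
      Ioc_subset_Ioi_self.eventuallyLE
  have hmono := intervalIntegral.integral_mono_on hδ.le intervalIntegrable_const
    (hsq.const_mul 2) hpt
  rw [intervalIntegral.integral_const, intervalIntegral.integral_const_mul, smul_eq_mul,
    sub_zero] at hmono
  have hdiv : ‖u 0‖ ^ 2 - 2 * δ * A ≤ 2 * (∫ t in Ioi (0 : ℝ), ‖u t‖ ^ 2) / δ := by
    rw [le_div_iff₀ hδ]
    linarith
  rw [div_mul_eq_mul_div]
  linarith

/-- The quadratic form is bounded below by a multiple of the `L²` norm, uniformly in `ξ`. -/
lemma neg_mul_le_qform {u u' : ℝ → ℂ} (h : AdmissibleHL u u') (γ ξ : ℝ) :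
    -(4 * (|γ| + 1) ^ 2) * (∫ t in Ioi (0 : ℝ), ‖u t‖ ^ 2) ≤ qform γ ξ u u' := by
  have hg : 0 < |γ| + 1 := by positivity
  have htr := h.trace_le (δ := 1 / (2 * (|γ| + 1))) (by positivity)
  have henergy : ∫ t in Ioi (0 : ℝ), ‖u' t‖ ^ 2 ≤
      ∫ t in Ioi (0 : ℝ), (‖u' t‖ ^ 2 + (t - ξ) ^ 2 * ‖u t‖ ^ 2) :=
    integral_mono h.memL2' (h.integrableOn_energy ξ) fun t => by
      have : 0 ≤ (t - ξ) ^ 2 * ‖u t‖ ^ 2 := by positivity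
      simpa using this
  have hmul := mul_le_mul_of_nonneg_left htr hg.le
  have hrw : ∀ N A : ℝ, (|γ| + 1) * (2 / (1 / (2 * (|γ| + 1))) * N +
      2 * (1 / (2 * (|γ| + 1))) * A) = 4 * (|γ| + 1) ^ 2 * N + A := by
    intro N A
    field_simp
    ring
  rw [hrw] at hmul
  have hγ : -(|γ| + 1) * ‖u 0‖ ^ 2 ≤ γ * ‖u 0‖ ^ 2 :=
    mul_le_mul_of_nonneg_right (by linarith [neg_abs_le γ]) (sq_nonneg _)
  unfold qform
  linarith

/-- The Rayleigh quotients are bounded below uniformly in `ξ`. -/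
lemma neg_le_rayleigh {u u' : ℝ → ℂ} (h : AdmissibleHL u u') (γ ξ : ℝ) :
    -(4 * (|γ| + 1) ^ 2) ≤ qform γ ξ u u' / ∫ t in Ioi (0 : ℝ), ‖u t‖ ^ 2 := by
  have hN : 0 ≤ ∫ t in Ioi (0 : ℝ), ‖u t‖ ^ 2 := integral_nonneg fun t => sq_nonneg _
  rcases hN.eq_or_lt with h0 | hpos
  · rw [← h0, div_zero, neg_nonpos]
    positivity
  · exact (le_div_iff₀ hpos).2 (h.neg_mul_le_qform γ ξ)

/-- The decaying exponential is admissible. -/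
lemma exp_neg :
    AdmissibleHL (fun t => (Real.exp (-t) : ℂ)) (fun t => -(Real.exp (-t) : ℂ)) where
  cont := by fun_prop
  locInt t _ := (by fun_prop : Continuous fun t : ℝ => -(Real.exp (-t) : ℂ)).intervalIntegrable 0 t
  ac t _ := by
    have hderiv : ∀ s ∈ uIcc 0 t,
        HasDerivAt (fun s : ℝ => (Real.exp (-s) : ℂ)) (-(Real.exp (-s) : ℂ)) s := by
      intro s _
      simpa using ((hasDerivAt_neg s).exp).ofReal_comp
    rw [intervalIntegral.integral_eq_sub_of_hasDerivAt hderiv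
      ((by fun_prop : Continuous fun t : ℝ => -(Real.exp (-t) : ℂ)).intervalIntegrable 0 t)]
    ring
  memL2 := by
    refine (integrableOn_exp_mul_Ioi (a := -2) (by norm_num) 0).congr_fun (fun t _ => ?_)
      measurableSet_Ioi
    simp [Complex.norm_exp, ← Real.exp_nat_mul]
  memL2' := by
    refine (integrableOn_exp_mul_Ioi (a := -2) (by norm_num) 0).congr_fun (fun t _ => ?_)
      measurableSet_Ioi
    simp [Complex.norm_exp, ← Real.exp_nat_mul]
  memL2t := by
    refine (integrableOn_rpow_mul_exp_neg_mul_rpow (p := 1) (s := 2) (b := 2) (by norm_num)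
      one_pos (by norm_num)).congr_fun (fun t _ => ?_) measurableSet_Ioi
    simp [Complex.norm_exp, ← Real.exp_nat_mul]

end AdmissibleHL

/-- The infimum `Θ(γ)` is a lower bound for every Rayleigh quotient. -/
lemma Theta_le_rayleigh {u u' : ℝ → ℂ} (h : AdmissibleHL u u')
    (hu : ∃ t ∈ Ici (0 : ℝ), u t ≠ 0) (γ ξ : ℝ) :
    Theta γ ≤ qform γ ξ u u' / ∫ t in Ioi (0 : ℝ), ‖u t‖ ^ 2 := by
  have hbdd : BddBelow (range fun ξ => mu1 γ ξ) := by
    refine ⟨-(4 * (|γ| + 1) ^ 2), ?_⟩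
    rintro _ ⟨η, rfl⟩
    refine Real.le_sInf ?_ (neg_nonpos.2 (by positivity))
    rintro _ ⟨v, v', hv, -, rfl⟩
    exact hv.neg_le_rayleigh γ η
  refine (ciInf_le hbdd ξ).trans (csInf_le ⟨-(4 * (|γ| + 1) ^ 2), ?_⟩ ⟨u, u', h, hu, rfl⟩)
  rintro _ ⟨v, v', hv, -, rfl⟩
  exact hv.neg_le_rayleigh γ ξ

/-- A lower bound for all Rayleigh quotients is a lower bound for `Θ(γ)`. -/
lemma le_Theta {γ c : ℝ}
    (hc : ∀ (ξ : ℝ) (u u' : ℝ → ℂ), AdmissibleHL u u' → (∃ t ∈ Ici (0 : ℝ), u t ≠ 0) →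
      c ≤ qform γ ξ u u' / ∫ t in Ioi (0 : ℝ), ‖u t‖ ^ 2) :
    c ≤ Theta γ := by
  refine le_ciInf fun ξ => le_csInf ⟨_, _, _, AdmissibleHL.exp_neg, ⟨0, by simp⟩, rfl⟩ ?_
  rintro _ ⟨u, u', hu, hne, rfl⟩
  exact hc ξ u u' hu hne

lemma monotone_Theta : Monotone Theta := by
  intro x y hxy
  refine le_Theta fun ξ u u' h hu => (Theta_le_rayleigh h hu x ξ).trans ?_
  refine div_le_div_of_nonneg_right ?_ (integral_nonneg fun t => sq_nonneg _)
  unfold qform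
  gcongr

/-- `Θ` is concave, being an infimum of affine functions. -/
lemma concaveOn_Theta : ConcaveOn ℝ univ Theta := by
  refine ⟨convex_univ, fun x _ y _ a b ha hb hab => le_Theta fun ξ u u' h hu => ?_⟩
  calc a • Theta x + b • Theta y
      ≤ a * (qform x ξ u u' / ∫ t in Ioi (0 : ℝ), ‖u t‖ ^ 2) +
        b * (qform y ξ u u' / ∫ t in Ioi (0 : ℝ), ‖u t‖ ^ 2) :=
        add_le_add (mul_le_mul_of_nonneg_left (Theta_le_rayleigh h hu x ξ) ha)
          (mul_le_mul_of_nonneg_left (Theta_le_rayleigh h hu y ξ) hb)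
    _ = _ := by
        obtain rfl : b = 1 - a := by linarith
        simp only [qform, smul_eq_mul]
        ring

/-- `Θ` is locally Lipschitz: for every `γ` there is `C > 0` with
`|Θ(γ+τ) − Θ(γ)| ≤ C·|τ|` for all `τ ∈ [−1,1]`. -/
theorem Theta_locally_lipschitz (γ : ℝ) :
    ∃ C > (0:ℝ), ∀ τ ∈ Icc (-1:ℝ) 1, |Theta (γ + τ) - Theta γ| ≤ C * |τ| := by
  have hmono : Theta (γ - 1) ≤ Theta γ := monotone_Theta (by linarith)
  refine ⟨Theta γ - Theta (γ - 1) + 1, by linarith, fun τ hτ => ?_⟩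
  rcases le_total 0 τ with h0 | h0
  · have hle : Theta γ ≤ Theta (γ + τ) := monotone_Theta (by linarith)
    have hpos : 0 < 1 + τ := by linarith
    have hconc := concaveOn_Theta.2 (mem_univ (γ + τ)) (mem_univ (γ - 1))
      (show 0 ≤ 1 / (1 + τ) by positivity) (show 0 ≤ τ / (1 + τ) by positivity) (by field_simp)
    have hpt : (1 / (1 + τ)) • (γ + τ) + (τ / (1 + τ)) • (γ - 1) = γ := by
      simp only [smul_eq_mul]
      field_simp
      ring
    rw [hpt, smul_eq_mul, smul_eq_mul, div_mul_eq_mul_div, div_mul_eq_mul_div, ← add_div,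
      div_le_iff₀ hpos] at hconc
    rw [abs_of_nonneg (by linarith), abs_of_nonneg h0]
    linarith
  · have hle : Theta (γ + τ) ≤ Theta γ := monotone_Theta (by linarith)
    have hconc := concaveOn_Theta.2 (mem_univ γ) (mem_univ (γ - 1))
      (show 0 ≤ 1 + τ by linarith [hτ.1]) (show 0 ≤ -τ by linarith) (by ring)
    have hpt : (1 + τ) • γ + (-τ) • (γ - 1) = γ + τ := by
      simp only [smul_eq_mul]
      ring
    rw [hpt, smul_eq_mul, smul_eq_mul] at hconc
    rw [abs_of_nonpos (by linarith), abs_of_nonpos h0]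
    linarith
end
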